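/- arXiv:2305.00349 — 10 statements merged into one kernel-verified Lean document; each statement's English description precedes it below -/
import Mathlib

section
/- The generalized frontdoor functional with covariates is a treatment-probability-weighted average: Ψ := ∑_{m,l} P(L=l) · P(M=m | A=a†, L=l) · ∑_{a∈{a†,a°}} E(Y | A=a, M=m, L=l) · P(A=a | L=l) satisfies Ψ = P(A=a†)·E(Y | A=a†) + P(A=a°)·∑_{m,l} E(Y | A=a°, M=m, L=l) · P(M=m | A=a†, L=l) · P(L=l | A=a°). -/
open scoped Classical
open Finset

/-- Probability of an event `S` under pmf `p` on a finite sample space. -/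
noncomputable def Pr {Ω : Type*} [Fintype Ω] (p : Ω → ℝ) (S : Ω → Prop) : ℝ :=
  ∑ ω, if S ω then p ω else 0

/-- Expectation of `X` under pmf `p`. -/
noncomputable def Ex {Ω : Type*} [Fintype Ω] (p : Ω → ℝ) (X : Ω → ℝ) : ℝ :=
  ∑ ω, p ω * X ω

/-- Conditional probability `P(E | S)`. -/
noncomputable def CPr {Ω : Type*} [Fintype Ω] (p : Ω → ℝ) (E S : Ω → Prop) : ℝ :=
  Pr p (fun ω => E ω ∧ S ω) / Pr p S

/-- Conditional expectation `E(X | S) = E(X · 1_S) / P(S)`. -/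
noncomputable def CEx {Ω : Type*} [Fintype Ω] (p : Ω → ℝ) (X : Ω → ℝ) (S : Ω → Prop) : ℝ :=
  Ex p (fun ω => X ω * (if S ω then 1 else 0)) / Pr p S

/-- Indicator of a proposition, as a real number. -/
noncomputable def ind (P : Prop) : ℝ := if P then 1 else 0

theorem Pr_mono_aux {Ω : Type*} [Fintype Ω] (p : Ω → ℝ) (hp : ∀ ω, 0 ≤ p ω)
    (S T : Ω → Prop) (h : ∀ ω, S ω → T ω) : Pr p S ≤ Pr p T := by
  unfold Pr
  apply Finset.sum_le_sum
  intro ω _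
  by_cases hS : S ω
  · simp [hS, h ω hS]
  · by_cases hT : T ω <;> simp [hS, hT, hp ω]

theorem Pr_congr_aux {Ω : Type*} [Fintype Ω] (p : Ω → ℝ)
    (S T : Ω → Prop) (h : ∀ ω, S ω ↔ T ω) : Pr p S = Pr p T := by
  have : S = T := funext fun ω => propext (h ω)
  rw [this]

theorem Ex_sum_aux {Ω 𝓜 𝓛 : Type*} [Fintype Ω] [Fintype 𝓜] [Fintype 𝓛] (p : Ω → ℝ)
    (S : Ω → Prop) (M : Ω → 𝓜) (L : Ω → 𝓛) (Y : Ω → ℝ) :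
    ∑ m : 𝓜, ∑ l : 𝓛, Ex p (fun ω => Y ω * (if S ω ∧ M ω = m ∧ L ω = l then 1 else 0))
      = Ex p (fun ω => Y ω * (if S ω then 1 else 0)) := by
  unfold Ex
  simp_rw [Finset.sum_comm (s := (Finset.univ : Finset 𝓛))]
  rw [Finset.sum_comm]
  apply Finset.sum_congr rfl
  intro ω _
  by_cases hS : S ω
  · simp only [hS, true_and, if_true, ite_and, ← Finset.mul_sum]
    simp
  · simp [hS]

/-- The generalized frontdoor functional with covariates is a
treatment-probability-weighted average. -/
theorem generalized_frontdoor_weighted_average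
    {Ω 𝓜 𝓛 α : Type*} [Fintype Ω] [Fintype 𝓜] [Fintype 𝓛]
    (p : Ω → ℝ) (hp : ∀ ω, 0 ≤ p ω) (hsum : ∑ ω, p ω = 1)
    (A : Ω → α) (adag acirc : α) (hne : adag ≠ acirc)
    (hA : ∀ ω, A ω = adag ∨ A ω = acirc)
    (M : Ω → 𝓜) (L : Ω → 𝓛) (Y : Ω → ℝ)
    (hpos : ∀ a, (a = adag ∨ a = acirc) → ∀ m : 𝓜, ∀ l : 𝓛,
      0 < Pr p (fun ω => A ω = a ∧ M ω = m ∧ L ω = l)) :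
    ∑ m : 𝓜, ∑ l : 𝓛,
      Pr p (fun ω => L ω = l) *
      CPr p (fun ω => M ω = m) (fun ω => A ω = adag ∧ L ω = l) *
      (CEx p Y (fun ω => A ω = adag ∧ M ω = m ∧ L ω = l) *
         CPr p (fun ω => A ω = adag) (fun ω => L ω = l) +
       CEx p Y (fun ω => A ω = acirc ∧ M ω = m ∧ L ω = l) *
         CPr p (fun ω => A ω = acirc) (fun ω => L ω = l))
    = Pr p (fun ω => A ω = adag) * CEx p Y (fun ω => A ω = adag) +
      Pr p (fun ω => A ω = acirc) *
        ∑ m : 𝓜, ∑ l : 𝓛,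
          CEx p Y (fun ω => A ω = acirc ∧ M ω = m ∧ L ω = l) *
          CPr p (fun ω => M ω = m) (fun ω => A ω = adag ∧ L ω = l) *
          CPr p (fun ω => L ω = l) (fun ω => A ω = acirc) := by
  obtain ⟨ω₀⟩ : Nonempty Ω := by
    by_contra h
    rw [not_nonempty_iff] at h
    simp at hsum
  have hD : Pr p (fun ω => A ω = adag) ≠ 0 := ne_of_gt <|
    (hpos adag (Or.inl rfl) (M ω₀) (L ω₀)).trans_le (Pr_mono_aux p hp _ _ fun ω h => h.1)
  have hC : Pr p (fun ω => A ω = acirc) ≠ 0 := ne_of_gt <|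
    (hpos acirc (Or.inr rfl) (M ω₀) (L ω₀)).trans_le (Pr_mono_aux p hp _ _ fun ω h => h.1)
  have e1 : Pr p (fun ω => A ω = adag) * CEx p Y (fun ω => A ω = adag)
      = ∑ m : 𝓜, ∑ l : 𝓛,
        Ex p (fun ω => Y ω * (if A ω = adag ∧ M ω = m ∧ L ω = l then 1 else 0)) := by
    rw [Ex_sum_aux p (fun ω => A ω = adag) M L Y]
    unfold CEx
    field_simp
  rw [e1, Finset.mul_sum, ← Finset.sum_add_distrib]
  apply Finset.sum_congr rfl
  intro m _
  rw [Finset.mul_sum, ← Finset.sum_add_distrib]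
  apply Finset.sum_congr rfl
  intro l _
  have h1 := (hpos adag (Or.inl rfl) m l).ne'
  have h2 : Pr p (fun ω => A ω = adag ∧ L ω = l) ≠ 0 := ne_of_gt <|
    (hpos adag (Or.inl rfl) m l).trans_le (Pr_mono_aux p hp _ _ fun ω h => ⟨h.1, h.2.2⟩)
  have h3 : Pr p (fun ω => L ω = l) ≠ 0 := ne_of_gt <|
    (hpos adag (Or.inl rfl) m l).trans_le (Pr_mono_aux p hp _ _ fun ω h => h.2.2)
  have h4 := (hpos acirc (Or.inr rfl) m l).ne'
  unfold CPr CEx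
  rw [Pr_congr_aux p (fun ω => M ω = m ∧ A ω = adag ∧ L ω = l)
      (fun ω => A ω = adag ∧ M ω = m ∧ L ω = l) (fun ω => by tauto),
    Pr_congr_aux p (fun ω => L ω = l ∧ A ω = acirc)
      (fun ω => A ω = acirc ∧ L ω = l) (fun ω => by tauto)]
  generalize Pr p (fun ω => A ω = adag ∧ M ω = m ∧ L ω = l) = x1 at *
  generalize Pr p (fun ω => A ω = acirc ∧ M ω = m ∧ L ω = l) = x2 at *
  generalize Pr p (fun ω => A ω = adag ∧ L ω = l) = x3 at *
  generalize Pr p (fun ω => A ω = acirc ∧ L ω = l) = x4 at *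
  generalize Pr p (fun ω => L ω = l) = x5 at *
  generalize Pr p (fun ω => A ω = acirc) = x6 at *
  field_simp
  ring_nf
end

section
/- For a treatment taking finitely many (possibly more than two) values, the generalized frontdoor functional decomposes as: Ψ := ∑_{m,l} P(L=l) · P(M=m | A=a†, L=l) · ∑_{a∈𝒜} E(Y | A=a, M=m, L=l) · P(A=a | L=l) satisfies Ψ = P(A=a†)·E(Y | A=a†) + ∑_{a°∈𝒜, a°≠a†} P(A=a°)·∑_{m,l} E(Y | A=a°, M=m, L=l) · P(M=m | A=a†, L=l) · P(L=l | A=a°). -/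
open scoped Classical
open Finset

theorem Pr_and_comm_aux {Ω : Type*} [Fintype Ω] (p : Ω → ℝ) (S T : Ω → Prop) :
    Pr p (fun ω => S ω ∧ T ω) = Pr p (fun ω => T ω ∧ S ω) := by
  congr 1
  funext ω
  exact propext and_comm

theorem Ex_split_aux {Ω 𝓜 𝓛 : Type*} [Fintype Ω] [Fintype 𝓜] [Fintype 𝓛]
    (p : Ω → ℝ) (Y : Ω → ℝ) (S : Ω → Prop) (M : Ω → 𝓜) (L : Ω → 𝓛) :
    ∑ m : 𝓜, ∑ l : 𝓛, Ex p (fun ω => Y ω * (if S ω ∧ M ω = m ∧ L ω = l then 1 else 0))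
      = Ex p (fun ω => Y ω * (if S ω then 1 else 0)) := by
  unfold Ex
  simp_rw [Finset.sum_comm (s := (Finset.univ : Finset 𝓛))]
  rw [Finset.sum_comm]
  refine Finset.sum_congr rfl fun ω _ => ?_
  by_cases hS : S ω
  · simp [hS, ite_and]
  · simp [hS]

/-- Decomposition of the generalized frontdoor functional for a
treatment taking finitely many (possibly more than two) values. -/
theorem generalized_frontdoor_weighted_average_multivalued
    {Ω 𝓜 𝓛 𝒜 : Type*} [Fintype Ω] [Fintype 𝓜] [Fintype 𝓛] [Fintype 𝒜]
    (p : Ω → ℝ) (hp : ∀ ω, 0 ≤ p ω) (hsum : ∑ ω, p ω = 1)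
    (A : Ω → 𝒜) (adag : 𝒜)
    (M : Ω → 𝓜) (L : Ω → 𝓛) (Y : Ω → ℝ)
    (hpos : ∀ a : 𝒜, ∀ m : 𝓜, ∀ l : 𝓛,
      0 < Pr p (fun ω => A ω = a ∧ M ω = m ∧ L ω = l)) :
    ∑ m : 𝓜, ∑ l : 𝓛,
      Pr p (fun ω => L ω = l) *
      CPr p (fun ω => M ω = m) (fun ω => A ω = adag ∧ L ω = l) *
      ∑ a : 𝒜, CEx p Y (fun ω => A ω = a ∧ M ω = m ∧ L ω = l) *
        CPr p (fun ω => A ω = a) (fun ω => L ω = l)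
    = Pr p (fun ω => A ω = adag) * CEx p Y (fun ω => A ω = adag) +
      ∑ acirc ∈ Finset.univ.filter (fun a : 𝒜 => a ≠ adag),
        Pr p (fun ω => A ω = acirc) *
          ∑ m : 𝓜, ∑ l : 𝓛,
            CEx p Y (fun ω => A ω = acirc ∧ M ω = m ∧ L ω = l) *
            CPr p (fun ω => M ω = m) (fun ω => A ω = adag ∧ L ω = l) *
            CPr p (fun ω => L ω = l) (fun ω => A ω = acirc) := by
  obtain ⟨ω₀⟩ : Nonempty Ω := by
    by_contra h
    rw [not_nonempty_iff] at h
    simp at hsum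
  have hAL : ∀ a l, 0 < Pr p (fun ω => A ω = a ∧ L ω = l) := fun a l =>
    lt_of_lt_of_le (hpos a (M ω₀) l) (Pr_mono_aux p hp _ _ fun ω h => ⟨h.1, h.2.2⟩)
  have hA : ∀ a, 0 < Pr p (fun ω => A ω = a) := fun a =>
    lt_of_lt_of_le (hAL a (L ω₀)) (Pr_mono_aux p hp _ _ fun ω h => h.1)
  have hL : ∀ l, 0 < Pr p (fun ω => L ω = l) := fun l =>
    lt_of_lt_of_le (hAL adag l) (Pr_mono_aux p hp _ _ fun ω h => h.2)
  have hΨ : ∑ m : 𝓜, ∑ l : 𝓛,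
      Pr p (fun ω => L ω = l) *
      CPr p (fun ω => M ω = m) (fun ω => A ω = adag ∧ L ω = l) *
      ∑ a : 𝒜, CEx p Y (fun ω => A ω = a ∧ M ω = m ∧ L ω = l) *
        CPr p (fun ω => A ω = a) (fun ω => L ω = l)
      = ∑ a : 𝒜, Pr p (fun ω => A ω = a) *
          ∑ m : 𝓜, ∑ l : 𝓛,
            CEx p Y (fun ω => A ω = a ∧ M ω = m ∧ L ω = l) *
            CPr p (fun ω => M ω = m) (fun ω => A ω = adag ∧ L ω = l) *
            CPr p (fun ω => L ω = l) (fun ω => A ω = a) := by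
    simp_rw [Finset.mul_sum]
    rw [Finset.sum_comm (s := (Finset.univ : Finset 𝒜))]
    refine Finset.sum_congr rfl fun m _ => ?_
    rw [Finset.sum_comm (s := (Finset.univ : Finset 𝒜))]
    refine Finset.sum_congr rfl fun l _ => Finset.sum_congr rfl fun a _ => ?_
    have h1 : Pr p (fun ω => L ω = l) * CPr p (fun ω => A ω = a) (fun ω => L ω = l)
        = Pr p (fun ω => A ω = a) * CPr p (fun ω => L ω = l) (fun ω => A ω = a) := by
      unfold CPr
      rw [mul_div_cancel₀ _ (hL l).ne', mul_div_cancel₀ _ (hA a).ne']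
      exact Pr_and_comm_aux p _ _
    linear_combination (CPr p (fun ω => M ω = m) (fun ω => A ω = adag ∧ L ω = l) *
      CEx p Y (fun ω => A ω = a ∧ M ω = m ∧ L ω = l)) * h1
  have hdag : ∑ m : 𝓜, ∑ l : 𝓛,
            CEx p Y (fun ω => A ω = adag ∧ M ω = m ∧ L ω = l) *
            CPr p (fun ω => M ω = m) (fun ω => A ω = adag ∧ L ω = l) *
            CPr p (fun ω => L ω = l) (fun ω => A ω = adag)
      = CEx p Y (fun ω => A ω = adag) := by
    have hr : CEx p Y (fun ω => A ω = adag)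
        = Ex p (fun ω => Y ω * (if A ω = adag then 1 else 0)) / Pr p (fun ω => A ω = adag) := rfl
    rw [hr, ← Ex_split_aux p Y (fun ω => A ω = adag) M L]
    simp_rw [Finset.sum_div]
    refine Finset.sum_congr rfl fun m _ => Finset.sum_congr rfl fun l _ => ?_
    unfold CEx CPr
    have e1 : Pr p (fun ω => M ω = m ∧ A ω = adag ∧ L ω = l)
        = Pr p (fun ω => A ω = adag ∧ M ω = m ∧ L ω = l) := by
      congr 1
      funext ω
      exact propext and_left_comm
    rw [e1, Pr_and_comm_aux p (fun ω => L ω = l) (fun ω => A ω = adag)]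
    have n1 := (hpos adag m l).ne'
    have n2 := (hAL adag l).ne'
    have n3 := (hA adag).ne'
    field_simp
    congr!
  rw [hΨ, ← hdag, Finset.filter_ne']
  exact (Finset.add_sum_erase Finset.univ (fun a => Pr p (fun ω => A ω = a) *
          ∑ m : 𝓜, ∑ l : 𝓛,
            CEx p Y (fun ω => A ω = a ∧ M ω = m ∧ L ω = l) *
            CPr p (fun ω => M ω = m) (fun ω => A ω = adag ∧ L ω = l) *
            CPr p (fun ω => L ω = l) (fun ω => A ω = a)) (Finset.mem_univ adag)).symm
end

section
/- Suppose (i) P(U=u | A=a, M=m) = P(U=u | A=a) for all u ∈ 𝒰, a ∈ {a†, a°}, m ∈ ℳ, and (ii) E(Y | A=a, M=m, U=u) = E(Y | M=m, U=u) for all a, m, u. Then for every m ∈ ℳ: ∑_{a∈{a†,a°}} E(Y | A=a, M=m) · P(A=a) = ∑_{u∈𝒰} E(Y | U=u, M=m) · P(U=u). -/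
open scoped Classical
open Finset

/-- Under `U ⫫ M | A` (in the sense (i)) and no direct effect of `A`
on `Y` given `(M,U)` (sense (ii)), the observed-data adjustment over `A` equals
the adjustment over the latent `U`, for every mediator value `m`. -/
theorem frontdoor_inner_term_latent_representation
    {Ω 𝓜 𝒰 α : Type*} [Fintype Ω] [Fintype 𝓜] [Fintype 𝒰]
    (p : Ω → ℝ) (hp : ∀ ω, 0 ≤ p ω) (hsum : ∑ ω, p ω = 1)
    (A : Ω → α) (adag acirc : α) (hne : adag ≠ acirc)
    (hA : ∀ ω, A ω = adag ∨ A ω = acirc)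
    (M : Ω → 𝓜) (U : Ω → 𝒰) (Y : Ω → ℝ)
    (hpos : ∀ a, (a = adag ∨ a = acirc) → ∀ m : 𝓜, ∀ u : 𝒰,
      0 < Pr p (fun ω => A ω = a ∧ M ω = m ∧ U ω = u))
    (hUindM : ∀ u : 𝒰, ∀ a, (a = adag ∨ a = acirc) → ∀ m : 𝓜,
      CPr p (fun ω => U ω = u) (fun ω => A ω = a ∧ M ω = m)
        = CPr p (fun ω => U ω = u) (fun ω => A ω = a))
    (hYnoA : ∀ a, (a = adag ∨ a = acirc) → ∀ m : 𝓜, ∀ u : 𝒰,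
      CEx p Y (fun ω => A ω = a ∧ M ω = m ∧ U ω = u)
        = CEx p Y (fun ω => M ω = m ∧ U ω = u)) :
    ∀ m : 𝓜,
      CEx p Y (fun ω => A ω = adag ∧ M ω = m) * Pr p (fun ω => A ω = adag) +
      CEx p Y (fun ω => A ω = acirc ∧ M ω = m) * Pr p (fun ω => A ω = acirc)
      = ∑ u : 𝒰, CEx p Y (fun ω => U ω = u ∧ M ω = m) * Pr p (fun ω => U ω = u) := by
  intro m
  have mono : ∀ S T : Ω → Prop, (∀ ω, S ω → T ω) → Pr p S ≤ Pr p T := by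
    intro S T h
    unfold Pr
    apply Finset.sum_le_sum
    intro ω _
    by_cases hS : S ω
    · simp [hS, h ω hS]
    · simp only [hS, if_false]
      split_ifs
      · exact hp ω
      · exact le_rfl
  have hΩ : Nonempty Ω := by
    by_contra h
    rw [not_nonempty_iff] at h
    simp at hsum
  obtain ⟨ω0⟩ := hΩ
  have key : ∀ a, (a = adag ∨ a = acirc) →
      CEx p Y (fun ω => A ω = a ∧ M ω = m) * Pr p (fun ω => A ω = a)
        = ∑ u : 𝒰, CEx p Y (fun ω => U ω = u ∧ M ω = m) *
            Pr p (fun ω => U ω = u ∧ A ω = a) := by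
    intro a ha
    have h1 : 0 < Pr p (fun ω => A ω = a ∧ M ω = m) :=
      lt_of_lt_of_le (hpos a ha m (U ω0)) (mono _ _ (fun ω h => ⟨h.1, h.2.1⟩))
    have h2 : 0 < Pr p (fun ω => A ω = a) :=
      lt_of_lt_of_le h1 (mono _ _ (fun ω h => h.1))
    have hE : Ex p (fun ω => Y ω * (if A ω = a ∧ M ω = m then 1 else 0))
        = ∑ u : 𝒰, Ex p (fun ω => Y ω * (if A ω = a ∧ M ω = m ∧ U ω = u then 1 else 0)) := by
      unfold Ex
      rw [Finset.sum_comm]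
      refine Finset.sum_congr rfl fun ω _ => ?_
      rw [← Finset.mul_sum, ← Finset.mul_sum]
      congr 2
      by_cases hh : A ω = a ∧ M ω = m
      · simp [hh.1, hh.2]
      · have : ∀ u, ¬ (A ω = a ∧ M ω = m ∧ U ω = u) := fun u h => hh ⟨h.1, h.2.1⟩
        simp only [hh, this, if_false, Finset.sum_const_zero]
    have hC : CEx p Y (fun ω => A ω = a ∧ M ω = m) * Pr p (fun ω => A ω = a)
        = ∑ u : 𝒰, Ex p (fun ω => Y ω * (if A ω = a ∧ M ω = m ∧ U ω = u then 1 else 0))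
          / Pr p (fun ω => A ω = a ∧ M ω = m) * Pr p (fun ω => A ω = a) := by
      rw [← Finset.sum_mul, ← Finset.sum_div, ← hE]
      unfold CEx
      congr!
    rw [hC]
    refine Finset.sum_congr rfl fun u _ => ?_
    have h3 := hpos a ha m u
    have hY := hYnoA a ha m u
    have hU := hUindM u a ha m
    have e1 : (fun ω => U ω = u ∧ M ω = m) = (fun ω => M ω = m ∧ U ω = u) := by
      funext ω; exact propext and_comm
    have e2 : (fun ω => U ω = u ∧ A ω = a ∧ M ω = m)
        = (fun ω => A ω = a ∧ M ω = m ∧ U ω = u) := by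
      funext ω; apply propext; tauto
    rw [e1, ← hY]
    unfold CPr at hU
    rw [e2] at hU
    unfold CEx
    rw [div_eq_div_iff h1.ne' h2.ne'] at hU
    rw [div_mul_eq_mul_div, div_mul_eq_mul_div, div_eq_div_iff h1.ne' h3.ne', mul_assoc,
      mul_assoc, mul_comm (Pr p fun ω => A ω = a), hU]
    congr!
  rw [key adag (Or.inl rfl), key acirc (Or.inr rfl), ← Finset.sum_add_distrib]
  refine Finset.sum_congr rfl fun u _ => ?_
  rw [← mul_add]
  congr 1
  unfold Pr
  rw [← Finset.sum_add_distrib]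
  refine Finset.sum_congr rfl fun ω _ => ?_
  rcases hA ω with h | h
  · simp [h, hne]
  · simp [h, hne.symm]
end

section
/- Observational frontdoor identity through a latent confounder: suppose (i) P(M=m | A=a, U=u) = P(M=m | A=a) for all a ∈ {a†, a°}, m ∈ ℳ, u ∈ 𝒰, and (ii) E(Y | A=a, M=m, U=u) = E(Y | M=m, U=u) for all a, m, u. Then ∑_{u∈𝒰} E(Y | A=a†, U=u) · P(U=u) = ∑_{m∈ℳ} P(M=m | A=a†) · ∑_{a∈{a†,a°}} E(Y | A=a, M=m) · P(A=a). -/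
open scoped Classical
open Finset

theorem fd_Pr_split {Ω β : Type*} [Fintype Ω] [Fintype β] (p : Ω → ℝ) (g : Ω → β)
    (S : Ω → Prop) (T : β → Ω → Prop) (h : ∀ b ω, T b ω ↔ (S ω ∧ g ω = b)) :
    Pr p S = ∑ b, Pr p (T b) := by
  unfold Pr
  rw [Finset.sum_comm]
  refine Finset.sum_congr rfl fun ω _ => ?_
  simp only [h]
  by_cases hS : S ω <;> simp [hS]

theorem fd_Ex_eq {Ω : Type*} [Fintype Ω] (p Y : Ω → ℝ) (S : Ω → Prop) :
    Ex p (fun ω => Y ω * (if S ω then 1 else 0)) = Pr (fun ω => p ω * Y ω) S := by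
  unfold Ex Pr
  refine Finset.sum_congr rfl fun ω _ => ?_
  by_cases hS : S ω <;> simp [hS]

/-- Observational frontdoor identity through a latent confounder. -/
theorem frontdoor_identity_through_latent_confounder
    {Ω 𝓜 𝒰 α : Type*} [Fintype Ω] [Fintype 𝓜] [Fintype 𝒰]
    (p : Ω → ℝ) (hp : ∀ ω, 0 ≤ p ω) (hsum : ∑ ω, p ω = 1)
    (A : Ω → α) (adag acirc : α) (hne : adag ≠ acirc)
    (hA : ∀ ω, A ω = adag ∨ A ω = acirc)
    (M : Ω → 𝓜) (U : Ω → 𝒰) (Y : Ω → ℝ)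
    (hpos : ∀ a, (a = adag ∨ a = acirc) → ∀ m : 𝓜, ∀ u : 𝒰,
      0 < Pr p (fun ω => A ω = a ∧ M ω = m ∧ U ω = u))
    (hMindU : ∀ a, (a = adag ∨ a = acirc) → ∀ m : 𝓜, ∀ u : 𝒰,
      CPr p (fun ω => M ω = m) (fun ω => A ω = a ∧ U ω = u)
        = CPr p (fun ω => M ω = m) (fun ω => A ω = a))
    (hYnoA : ∀ a, (a = adag ∨ a = acirc) → ∀ m : 𝓜, ∀ u : 𝒰,
      CEx p Y (fun ω => A ω = a ∧ M ω = m ∧ U ω = u)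
        = CEx p Y (fun ω => M ω = m ∧ U ω = u)) :
    ∑ u : 𝒰, CEx p Y (fun ω => A ω = adag ∧ U ω = u) * Pr p (fun ω => U ω = u)
    = ∑ m : 𝓜, CPr p (fun ω => M ω = m) (fun ω => A ω = adag) *
        (CEx p Y (fun ω => A ω = adag ∧ M ω = m) * Pr p (fun ω => A ω = adag) +
         CEx p Y (fun ω => A ω = acirc ∧ M ω = m) * Pr p (fun ω => A ω = acirc)) := by
  obtain ⟨ω₀⟩ : Nonempty Ω := by
    by_contra hc
    rw [not_nonempty_iff] at hc
    simp at hsum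
  haveI : Nonempty 𝓜 := ⟨M ω₀⟩
  haveI : Nonempty 𝒰 := ⟨U ω₀⟩
  obtain ⟨q, hq⟩ : ∃ q : α → 𝓜 → 𝒰 → ℝ,
      ∀ a m u, Pr p (fun ω => A ω = a ∧ M ω = m ∧ U ω = u) = q a m u := ⟨_, fun _ _ _ => rfl⟩
  obtain ⟨e, he⟩ : ∃ e : 𝓜 → 𝒰 → ℝ,
      ∀ m u, CEx p Y (fun ω => M ω = m ∧ U ω = u) = e m u := ⟨_, fun _ _ => rfl⟩
  obtain ⟨r, hr⟩ : ∃ r : α → 𝒰 → ℝ,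
      ∀ a u, Pr p (fun ω => A ω = a ∧ U ω = u) = r a u := ⟨_, fun _ _ => rfl⟩
  obtain ⟨t, ht⟩ : ∃ t : α → ℝ, ∀ a, Pr p (fun ω => A ω = a) = t a := ⟨_, fun _ => rfl⟩
  obtain ⟨k, hk⟩ : ∃ k : α → 𝓜 → ℝ,
      ∀ a m, CPr p (fun ω => M ω = m) (fun ω => A ω = a) = k a m := ⟨_, fun _ _ => rfl⟩
  simp only [hq, hk, he] at hpos hMindU hYnoA
  have hrq : ∀ a u, r a u = ∑ m, q a m u := fun a u => by
    rw [← hr, fd_Pr_split p M _ (fun m ω => A ω = a ∧ M ω = m ∧ U ω = u) (by intros; tauto)]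
    simp only [hq]
  have htr : ∀ a, t a = ∑ u, r a u := fun a => by
    rw [← ht, fd_Pr_split p U _ (fun u ω => A ω = a ∧ U ω = u) (by intros; tauto)]
    simp only [hr]
  have hrpos : ∀ a, (a = adag ∨ a = acirc) → ∀ u, 0 < r a u := fun a ha u => by
    rw [hrq]; exact Finset.sum_pos (fun m _ => hpos a ha m u) Finset.univ_nonempty
  have htpos : ∀ a, (a = adag ∨ a = acirc) → 0 < t a := fun a ha => by
    rw [htr]; exact Finset.sum_pos (fun u _ => hrpos a ha u) Finset.univ_nonempty
  have hqk : ∀ a, (a = adag ∨ a = acirc) → ∀ m u, q a m u = k a m * r a u := fun a ha m u => by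
    have h := hMindU a ha m u
    unfold CPr at h
    have h2 : Pr p (fun ω => M ω = m ∧ A ω = a ∧ U ω = u) = q a m u := by
      rw [← hq]; congr 1; funext ω; apply propext; tauto
    rw [h2, hr, div_eq_iff (hrpos a ha u).ne'] at h
    exact h
  have hkpos : ∀ a, (a = adag ∨ a = acirc) → ∀ m, k a m ≠ 0 := fun a ha m h0 => by
    have h1 := hpos a ha m (U ω₀)
    rw [hqk a ha, h0] at h1
    simp at h1
  have hN : ∀ a, (a = adag ∨ a = acirc) → ∀ m u,
      Pr (fun ω => p ω * Y ω) (fun ω => A ω = a ∧ M ω = m ∧ U ω = u)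
        = e m u * q a m u := fun a ha m u => by
    have h := hYnoA a ha m u
    unfold CEx at h
    rw [fd_Ex_eq, hq, div_eq_iff (hpos a ha m u).ne'] at h
    exact h
  have hU : ∀ u, Pr p (fun ω => U ω = u) = r adag u + r acirc u := fun u => by
    rw [← hr, ← hr]
    unfold Pr
    rw [← Finset.sum_add_distrib]
    refine Finset.sum_congr rfl fun ω _ => ?_
    rcases hA ω with h | h
    · simp [h, hne]
    · simp [h, hne.symm]
  have hL : ∀ u, CEx p Y (fun ω => A ω = adag ∧ U ω = u) = ∑ m, e m u * k adag m := fun u => by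
    unfold CEx
    rw [fd_Ex_eq, hr, div_eq_iff (hrpos adag (Or.inl rfl) u).ne',
      fd_Pr_split _ M _ (fun m ω => A ω = adag ∧ M ω = m ∧ U ω = u) (by intros; tauto),
      Finset.sum_mul]
    refine Finset.sum_congr rfl fun m _ => ?_
    rw [hN adag (Or.inl rfl), hqk adag (Or.inl rfl)]; ring
  have hR : ∀ a, (a = adag ∨ a = acirc) → ∀ m,
      CEx p Y (fun ω => A ω = a ∧ M ω = m) * t a = ∑ u, e m u * r a u := fun a ha m => by
    have hs : Pr p (fun ω => A ω = a ∧ M ω = m) = k a m * t a := by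
      rw [fd_Pr_split _ U _ (fun u ω => A ω = a ∧ M ω = m ∧ U ω = u) (by intros; tauto), htr,
        Finset.mul_sum]
      refine Finset.sum_congr rfl fun u _ => ?_
      rw [hq, hqk a ha]
    have hs2 : Pr (fun ω => p ω * Y ω) (fun ω => A ω = a ∧ M ω = m)
        = k a m * ∑ u, e m u * r a u := by
      rw [fd_Pr_split _ U _ (fun u ω => A ω = a ∧ M ω = m ∧ U ω = u) (by intros; tauto),
        Finset.mul_sum]
      refine Finset.sum_congr rfl fun u _ => ?_
      rw [hN a ha, hqk a ha]; ring
    have h1 := hkpos a ha m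
    have h2 := (htpos a ha).ne'
    unfold CEx
    rw [fd_Ex_eq, hs, hs2]
    field_simp
  simp only [hL, hU, hk, ht, hR adag (Or.inl rfl), hR acirc (Or.inr rfl)]
  simp only [Finset.sum_mul, ← Finset.sum_add_distrib, Finset.mul_sum]
  rw [Finset.sum_comm]
  refine Finset.sum_congr rfl fun m _ => Finset.sum_congr rfl fun u _ => ?_
  ring
end

section
/- The efficient influence function of the frontdoor formula has mean zero: define b₀(m) = E(Y | A=a°, M=m), ψ₃ = ∑_m b₀(m)·P(M=m | A=a†), and Ψ = P(A=a†)·E(Y | A=a†) + P(A=a°)·ψ₃. Then E[ 1{A=a†}·Y + 1{A=a°}·ψ₃ + (P(A=a°)/P(A=a†))·( 1{A=a°}·(P(A=a† | M)/P(A=a° | M))·(Y − b₀(M)) + 1{A=a†}·(b₀(M) − ψ₃) ) − Ψ ] = 0. -/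
open scoped Classical
open Finset

/-- The efficient influence function of the frontdoor formula has
mean zero. -/
theorem frontdoor_eif_mean_zero
    {Ω 𝓜 α : Type*} [Fintype Ω] [Fintype 𝓜]
    (p : Ω → ℝ) (hp : ∀ ω, 0 ≤ p ω) (hsum : ∑ ω, p ω = 1)
    (A : Ω → α) (adag acirc : α) (hne : adag ≠ acirc)
    (hA : ∀ ω, A ω = adag ∨ A ω = acirc)
    (M : Ω → 𝓜) (Y : Ω → ℝ)
    (hpos : ∀ a, (a = adag ∨ a = acirc) → ∀ m : 𝓜,
      0 < Pr p (fun ω => A ω = a ∧ M ω = m))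
    (b0 : 𝓜 → ℝ)
    (hb0 : ∀ m, b0 m = CEx p Y (fun ω => A ω = acirc ∧ M ω = m))
    (ψ3 : ℝ)
    (hψ3 : ψ3 = ∑ m : 𝓜, b0 m * CPr p (fun ω => M ω = m) (fun ω => A ω = adag))
    (Ψ : ℝ)
    (hΨ : Ψ = Pr p (fun ω => A ω = adag) * CEx p Y (fun ω => A ω = adag) +
              Pr p (fun ω => A ω = acirc) * ψ3) :
    Ex p (fun ω =>
      ind (A ω = adag) * Y ω + ind (A ω = acirc) * ψ3 +
      (Pr p (fun ω' => A ω' = acirc) / Pr p (fun ω' => A ω' = adag)) *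
        (ind (A ω = acirc) *
           (CPr p (fun ω' => A ω' = adag) (fun ω' => M ω' = M ω) /
            CPr p (fun ω' => A ω' = acirc) (fun ω' => M ω' = M ω)) *
           (Y ω - b0 (M ω)) +
         ind (A ω = adag) * (b0 (M ω) - ψ3)) - Ψ) = 0 := by
  obtain ⟨ω0⟩ : Nonempty Ω := by
    by_contra h
    rw [not_nonempty_iff] at h
    simp at hsum
  have hPd : 0 < Pr p (fun ω => A ω = adag) := by
    refine lt_of_lt_of_le (hpos adag (Or.inl rfl) (M ω0)) ?_
    unfold Pr
    apply Finset.sum_le_sum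
    intro ω _
    by_cases h1 : A ω = adag <;> by_cases h2 : M ω = M ω0 <;> simp [h1, h2, hp ω]
  have h1 : ∑ ω, p ω * (ind (A ω = adag) * Y ω)
      = Pr p (fun ω => A ω = adag) * CEx p Y (fun ω => A ω = adag) := by
    unfold CEx
    rw [mul_div_cancel₀ _ hPd.ne']
    unfold Ex ind
    exact Finset.sum_congr rfl fun ω _ => by ring
  have h2 : ∀ a, ∑ ω, p ω * ind (A ω = a) = Pr p (fun ω => A ω = a) := by
    intro a
    unfold Pr ind
    exact Finset.sum_congr rfl fun ω _ => by simp
  have h3 : ∀ g : 𝓜 → ℝ,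
      ∑ ω, p ω * (ind (A ω = acirc) * g (M ω) * (Y ω - b0 (M ω))) = 0 := by
    intro g
    rw [← Finset.sum_fiberwise Finset.univ M]
    apply Finset.sum_eq_zero
    intro m _
    have hm := hb0 m
    have hq := hpos acirc (Or.inr rfl) m
    unfold CEx at hm
    rw [eq_div_iff hq.ne'] at hm
    unfold Ex Pr at hm
    have : g m * (∑ ω, p ω * (Y ω * (if A ω = acirc ∧ M ω = m then 1 else 0))
        - b0 m * ∑ ω, if A ω = acirc ∧ M ω = m then p ω else 0) = 0 := by
      have hm2 : (b0 m * ∑ ω, if A ω = acirc ∧ M ω = m then p ω else 0)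
          = ∑ ω, p ω * (Y ω * (if A ω = acirc ∧ M ω = m then 1 else 0)) := by
        convert hm
      rw [hm2]; ring
    rw [← this, Finset.mul_sum, ← Finset.sum_sub_distrib, Finset.mul_sum, Finset.sum_filter]
    apply Finset.sum_congr rfl
    intro ω _
    by_cases e1 : A ω = acirc <;> by_cases e2 : M ω = m <;> simp [ind, e1, e2]
    ring
  have h4 : ∑ ω, p ω * (ind (A ω = adag) * b0 (M ω))
      = Pr p (fun ω => A ω = adag) * ψ3 := by
    rw [hψ3, Finset.mul_sum, ← Finset.sum_fiberwise Finset.univ M]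
    apply Finset.sum_congr rfl
    intro m _
    unfold CPr
    rw [mul_left_comm, mul_div_cancel₀ _ hPd.ne']
    unfold Pr
    rw [Finset.mul_sum, Finset.sum_filter]
    apply Finset.sum_congr rfl
    intro ω _
    by_cases e1 : A ω = adag <;> by_cases e2 : M ω = m <;> simp [ind, e1, e2]
    ring
  have h3' := h3 (fun m => CPr p (fun ω' => A ω' = adag) (fun ω' => M ω' = m) /
            CPr p (fun ω' => A ω' = acirc) (fun ω' => M ω' = m))
  have hd := h2 adag
  have hc := h2 acirc
  set r := Pr p (fun ω' => A ω' = acirc) / Pr p (fun ω' => A ω' = adag)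
  unfold Ex
  trans (∑ ω, p ω * (ind (A ω = adag) * Y ω)) + (∑ ω, p ω * ind (A ω = acirc)) * ψ3
    + r * ((∑ ω, p ω * (ind (A ω = acirc) *
           (CPr p (fun ω' => A ω' = adag) (fun ω' => M ω' = M ω) /
            CPr p (fun ω' => A ω' = acirc) (fun ω' => M ω' = M ω)) *
           (Y ω - b0 (M ω)))) + ((∑ ω, p ω * (ind (A ω = adag) * b0 (M ω)))
           - (∑ ω, p ω * ind (A ω = adag)) * ψ3)) - (∑ ω, p ω) * Ψ
  · simp only [Finset.sum_mul, ← Finset.sum_sub_distrib, ← Finset.sum_add_distrib,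
      Finset.mul_sum]
    exact Finset.sum_congr rfl fun ω _ => by ring
  · rw [h1, hc, h3', h4, hd, hsum, hΨ]
    ring
end

section
/- Robustness of the frontdoor estimating function under a correct propensity model: define b₀(m) = E(Y | A=a°, M=m), ψ₃ = ∑_m b₀(m)·P(M=m | A=a†), and Ψ = P(A=a†)·E(Y | A=a†) + P(A=a°)·ψ₃. Then for ANY function b₀* : ℳ → ℝ and ANY real number ψ₃*, E[ 1{A=a†}·Y + 1{A=a°}·ψ₃* + (P(A=a°)/P(A=a†))·( 1{A=a°}·(P(A=a† | M)/P(A=a° | M))·(Y − b₀*(M)) + 1{A=a†}·(b₀*(M) − ψ₃*) ) ] = Ψ. -/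
open scoped Classical
open Finset

theorem fiber_aux {Ω 𝓜 : Type*} [Fintype Ω] [Fintype 𝓜] (M : Ω → 𝓜) (F : Ω → ℝ) (g : 𝓜 → ℝ) :
    ∑ ω, F ω * g (M ω) = ∑ m, g m * ∑ ω, if M ω = m then F ω else 0 := by
  simp only [Finset.mul_sum]
  rw [Finset.sum_comm]
  refine Finset.sum_congr rfl fun ω _ => ?_
  simp [mul_comm]

/-- Robustness of the frontdoor estimating function under a correct
propensity model: arbitrary outcome nuisances `b0star`, `ψ3star`. -/
theorem frontdoor_robust_propensity
    {Ω 𝓜 α : Type*} [Fintype Ω] [Fintype 𝓜]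
    (p : Ω → ℝ) (hp : ∀ ω, 0 ≤ p ω) (hsum : ∑ ω, p ω = 1)
    (A : Ω → α) (adag acirc : α) (hne : adag ≠ acirc)
    (hA : ∀ ω, A ω = adag ∨ A ω = acirc)
    (M : Ω → 𝓜) (Y : Ω → ℝ)
    (hpos : ∀ a, (a = adag ∨ a = acirc) → ∀ m : 𝓜,
      0 < Pr p (fun ω => A ω = a ∧ M ω = m))
    (b0 : 𝓜 → ℝ)
    (hb0 : ∀ m, b0 m = CEx p Y (fun ω => A ω = acirc ∧ M ω = m))
    (ψ3 : ℝ)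
    (hψ3 : ψ3 = ∑ m : 𝓜, b0 m * CPr p (fun ω => M ω = m) (fun ω => A ω = adag))
    (Ψ : ℝ)
    (hΨ : Ψ = Pr p (fun ω => A ω = adag) * CEx p Y (fun ω => A ω = adag) +
              Pr p (fun ω => A ω = acirc) * ψ3)
    (b0star : 𝓜 → ℝ) (ψ3star : ℝ) :
    Ex p (fun ω =>
      ind (A ω = adag) * Y ω + ind (A ω = acirc) * ψ3star +
      (Pr p (fun ω' => A ω' = acirc) / Pr p (fun ω' => A ω' = adag)) *
        (ind (A ω = acirc) *
           (CPr p (fun ω' => A ω' = adag) (fun ω' => M ω' = M ω) /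
            CPr p (fun ω' => A ω' = acirc) (fun ω' => M ω' = M ω)) *
           (Y ω - b0star (M ω)) +
         ind (A ω = adag) * (b0star (M ω) - ψ3star))) = Ψ := by
  have hd := hpos adag (Or.inl rfl)
  have hc := hpos acirc (Or.inr rfl)
  have hmono : ∀ S T : Ω → Prop, (∀ ω, S ω → T ω) → Pr p S ≤ Pr p T := by
    intro S T h
    unfold Pr
    refine Finset.sum_le_sum fun ω _ => ?_
    have h1 := h ω
    have h2 := hp ω
    by_cases hS : S ω
    · simp [hS, h1 hS]
    · by_cases hT : T ω <;> simp [hS, hT, h2]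
  have hΩ : Nonempty Ω := by
    by_contra h
    rw [not_nonempty_iff] at h
    simp at hsum
  obtain ⟨ω0⟩ := hΩ
  have hD : 0 < Pr p (fun ω => A ω = adag) :=
    lt_of_lt_of_le (hd (M ω0)) (hmono _ _ fun ω h => h.1)
  have hM : ∀ m, 0 < Pr p (fun ω => M ω = m) := fun m =>
    lt_of_lt_of_le (hd m) (hmono _ _ fun ω h => h.2)
  have hratio : ∀ m, CPr p (fun ω' => A ω' = adag) (fun ω' => M ω' = m) /
      CPr p (fun ω' => A ω' = acirc) (fun ω' => M ω' = m) =
      Pr p (fun ω => A ω = adag ∧ M ω = m) / Pr p (fun ω => A ω = acirc ∧ M ω = m) := by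
    intro m
    have h1 := (hM m).ne'
    have h2 := (hc m).ne'
    unfold CPr
    field_simp
  set d : 𝓜 → ℝ := fun m => Pr p (fun ω => A ω = adag ∧ M ω = m) with hdd
  set c : 𝓜 → ℝ := fun m => Pr p (fun ω => A ω = acirc ∧ M ω = m) with hcc
  have hratio' : ∀ m, CPr p (fun ω' => A ω' = adag) (fun ω' => M ω' = m) /
      CPr p (fun ω' => A ω' = acirc) (fun ω' => M ω' = m) = d m / c m := hratio
  have hfib : ∀ a (g : 𝓜 → ℝ), ∑ ω, p ω * ind (A ω = a) * g (M ω) =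
      ∑ m, g m * Pr p (fun ω => A ω = a ∧ M ω = m) := by
    intro a g
    rw [fiber_aux M (fun ω => p ω * ind (A ω = a)) g]
    refine Finset.sum_congr rfl fun m _ => ?_
    unfold Pr ind
    congr 1
    refine Finset.sum_congr rfl fun ω _ => ?_
    by_cases h1 : A ω = a <;> by_cases h2 : M ω = m <;> simp [h1, h2]
  have hfibY : ∑ ω, p ω * ind (A ω = acirc) * Y ω * (d (M ω) / c (M ω)) =
      ∑ m, b0 m * d m := by
    rw [fiber_aux M (fun ω => p ω * ind (A ω = acirc) * Y ω) (fun m => d m / c m)]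
    refine Finset.sum_congr rfl fun m _ => ?_
    have hcm : c m ≠ 0 := (hc m).ne'
    have : b0 m = (∑ ω, if M ω = m then p ω * ind (A ω = acirc) * Y ω else 0) / c m := by
      rw [hb0 m]
      unfold CEx Ex
      congr 1
      refine Finset.sum_congr rfl fun ω _ => ?_
      unfold ind
      by_cases h1 : A ω = acirc <;> by_cases h2 : M ω = m <;> simp [h1, h2]
    rw [this]
    field_simp
  have hP : ∀ a, ∑ ω, p ω * ind (A ω = a) = Pr p (fun ω => A ω = a) := by
    intro a
    unfold Pr ind
    simp
  have hb1 : ∑ ω, p ω * ind (A ω = acirc) * (d (M ω) / c (M ω) * b0star (M ω)) =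
      ∑ m, b0star m * d m := by
    rw [hfib acirc (fun m => d m / c m * b0star m)]
    refine Finset.sum_congr rfl fun m _ => ?_
    have hcm : c m ≠ 0 := (hc m).ne'
    change d m / c m * b0star m * c m = _
    field_simp
  have hb2 : ∑ ω, p ω * ind (A ω = adag) * b0star (M ω) = ∑ m, b0star m * d m :=
    hfib adag b0star
  have hψ : ψ3 = (∑ m, b0 m * d m) / Pr p (fun ω => A ω = adag) := by
    rw [hψ3, Finset.sum_div]
    refine Finset.sum_congr rfl fun m _ => ?_
    simp only [CPr, hdd, and_comm, mul_div_assoc]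
  have hY : CEx p Y (fun ω => A ω = adag) =
      (∑ ω, p ω * ind (A ω = adag) * Y ω) / Pr p (fun ω => A ω = adag) := by
    unfold CEx Ex ind
    congr 1
    refine Finset.sum_congr rfl fun ω _ => ?_
    ring
  simp only [hratio']
  set D := Pr p (fun ω => A ω = adag)
  set C := Pr p (fun ω => A ω = acirc)
  have key : Ex p (fun ω =>
      ind (A ω = adag) * Y ω + ind (A ω = acirc) * ψ3star +
      (C / D) * (ind (A ω = acirc) * (d (M ω) / c (M ω)) * (Y ω - b0star (M ω)) +
         ind (A ω = adag) * (b0star (M ω) - ψ3star))) =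
      (∑ ω, p ω * ind (A ω = adag) * Y ω) + (∑ ω, p ω * ind (A ω = acirc)) * ψ3star +
      (C / D) * ((∑ ω, p ω * ind (A ω = acirc) * Y ω * (d (M ω) / c (M ω))) -
        (∑ ω, p ω * ind (A ω = acirc) * (d (M ω) / c (M ω) * b0star (M ω))) +
        (∑ ω, p ω * ind (A ω = adag) * b0star (M ω)) -
        (∑ ω, p ω * ind (A ω = adag)) * ψ3star) := by
    unfold Ex
    simp only [Finset.sum_mul, ← Finset.sum_add_distrib, ← Finset.sum_sub_distrib, Finset.mul_sum]
    refine Finset.sum_congr rfl fun ω _ => ?_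
    ring
  rw [key, hfibY, hb1, hb2, hP, hP, hΨ, hψ, hY]
  change _ + C * ψ3star + C / D * (_ - _ + _ - D * ψ3star) = _
  have hD0 : D ≠ 0 := hD.ne'
  field_simp
  ring
end

section
/- Robustness of the frontdoor estimating function under a correct outcome model: define b₀(m) = E(Y | A=a°, M=m), ψ₃ = ∑_m b₀(m)·P(M=m | A=a†), and Ψ = P(A=a†)·E(Y | A=a†) + P(A=a°)·ψ₃. Then for ANY function r : ℳ → ℝ (an arbitrary, possibly misspecified, propensity odds ratio), E[ 1{A=a†}·Y + 1{A=a°}·ψ₃ + (P(A=a°)/P(A=a†))·( 1{A=a°}·r(M)·(Y − b₀(M)) + 1{A=a†}·(b₀(M) − ψ₃) ) ] = Ψ. -/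
open scoped Classical
open Finset

/-- Robustness of the frontdoor estimating function under a correct
outcome model: arbitrary (possibly misspecified) propensity odds ratio `r`. -/
theorem frontdoor_robust_outcome
    {Ω 𝓜 α : Type*} [Fintype Ω] [Fintype 𝓜]
    (p : Ω → ℝ) (hp : ∀ ω, 0 ≤ p ω) (hsum : ∑ ω, p ω = 1)
    (A : Ω → α) (adag acirc : α) (hne : adag ≠ acirc)
    (hA : ∀ ω, A ω = adag ∨ A ω = acirc)
    (M : Ω → 𝓜) (Y : Ω → ℝ)
    (hpos : ∀ a, (a = adag ∨ a = acirc) → ∀ m : 𝓜,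
      0 < Pr p (fun ω => A ω = a ∧ M ω = m))
    (b0 : 𝓜 → ℝ)
    (hb0 : ∀ m, b0 m = CEx p Y (fun ω => A ω = acirc ∧ M ω = m))
    (ψ3 : ℝ)
    (hψ3 : ψ3 = ∑ m : 𝓜, b0 m * CPr p (fun ω => M ω = m) (fun ω => A ω = adag))
    (Ψ : ℝ)
    (hΨ : Ψ = Pr p (fun ω => A ω = adag) * CEx p Y (fun ω => A ω = adag) +
              Pr p (fun ω => A ω = acirc) * ψ3)
    (r : 𝓜 → ℝ) :
    Ex p (fun ω =>
      ind (A ω = adag) * Y ω + ind (A ω = acirc) * ψ3 +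
      (Pr p (fun ω' => A ω' = acirc) / Pr p (fun ω' => A ω' = adag)) *
        (ind (A ω = acirc) * r (M ω) * (Y ω - b0 (M ω)) +
         ind (A ω = adag) * (b0 (M ω) - ψ3))) = Ψ := by
  obtain ⟨ω0⟩ : Nonempty Ω := by
    by_contra h
    rw [not_nonempty_iff] at h
    simp at hsum
  have hD : 0 < Pr p (fun ω => A ω = adag) := by
    refine lt_of_lt_of_le (hpos adag (Or.inl rfl) (M ω0)) ?_
    unfold Pr
    refine Finset.sum_le_sum fun ω _ => ?_
    have := hp ω
    by_cases h1 : A ω = adag <;> by_cases h2 : M ω = M ω0 <;> simp [h1, h2, this]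
  have fib : ∀ f : Ω → ℝ, ∑ ω, f ω = ∑ m : 𝓜, ∑ ω, if M ω = m then f ω else 0 := by
    intro f
    rw [Finset.sum_comm]
    simp
  -- residual term vanishes
  have h1 : ∑ ω, p ω * (ind (A ω = acirc) * r (M ω) * (Y ω - b0 (M ω))) = 0 := by
    rw [fib]
    refine Finset.sum_eq_zero fun m _ => ?_
    have hq := hpos acirc (Or.inr rfl) m
    have hb : b0 m * Pr p (fun ω => A ω = acirc ∧ M ω = m) =
        Ex p (fun ω => Y ω * (if A ω = acirc ∧ M ω = m then 1 else 0)) := by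
      rw [hb0 m, CEx, div_mul_cancel₀ _ hq.ne']
      congr!
    have : ∑ ω, (if M ω = m then p ω * (ind (A ω = acirc) * r (M ω) * (Y ω - b0 (M ω))) else 0)
        = r m * (Ex p (fun ω => Y ω * (if A ω = acirc ∧ M ω = m then 1 else 0)) -
          b0 m * Pr p (fun ω => A ω = acirc ∧ M ω = m)) := by
      unfold Ex Pr
      rw [Finset.mul_sum, ← Finset.sum_sub_distrib, Finset.mul_sum]
      refine Finset.sum_congr rfl fun ω _ => ?_
      by_cases h2 : M ω = m
      · by_cases h1 : A ω = acirc
        · simp [h1, h2, ind]; ring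
        · simp [h1, ind]
      · simp [h2]
    rw [this, hb]; ring
  have h2 : ∑ ω, p ω * (ind (A ω = adag) * b0 (M ω)) = Pr p (fun ω => A ω = adag) * ψ3 := by
    rw [fib, hψ3, Finset.mul_sum]
    refine Finset.sum_congr rfl fun m _ => ?_
    have : Pr p (fun ω => A ω = adag) * (b0 m * CPr p (fun ω => M ω = m) (fun ω => A ω = adag))
        = b0 m * Pr p (fun ω => M ω = m ∧ A ω = adag) := by
      unfold CPr
      field_simp
    rw [this]
    unfold Pr
    rw [Finset.mul_sum]
    refine Finset.sum_congr rfl fun ω _ => ?_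
    by_cases h2 : M ω = m
    · by_cases h1 : A ω = adag
      · simp [h1, h2, ind]; ring
      · simp [h1, ind]
    · simp [h2]
  have h3 : ∀ a, ∑ ω, p ω * ind (A ω = a) = Pr p (fun ω => A ω = a) := by
    intro a
    simp [Pr, ind]
  have h4 : Pr p (fun ω => A ω = adag) * CEx p Y (fun ω => A ω = adag) =
      ∑ ω, p ω * (ind (A ω = adag) * Y ω) := by
    rw [CEx, mul_div_cancel₀ _ hD.ne', Ex]
    refine Finset.sum_congr rfl fun ω _ => ?_
    unfold ind
    ring
  rw [hΨ, h4]
  generalize Pr p (fun ω => A ω = acirc) / Pr p (fun ω => A ω = adag) = c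
  have h5 : Ex p (fun ω =>
      ind (A ω = adag) * Y ω + ind (A ω = acirc) * ψ3 +
      c * (ind (A ω = acirc) * r (M ω) * (Y ω - b0 (M ω)) +
         ind (A ω = adag) * (b0 (M ω) - ψ3))) =
      ∑ ω, p ω * (ind (A ω = adag) * Y ω) + (∑ ω, p ω * ind (A ω = acirc)) * ψ3 +
      c * (∑ ω, p ω * (ind (A ω = acirc) * r (M ω) * (Y ω - b0 (M ω))) +
        (∑ ω, p ω * (ind (A ω = adag) * b0 (M ω)) - (∑ ω, p ω * ind (A ω = adag)) * ψ3)) := by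
    unfold Ex
    rw [Finset.sum_mul, Finset.sum_mul, ← Finset.sum_sub_distrib, ← Finset.sum_add_distrib,
      ← Finset.sum_add_distrib, Finset.mul_sum, ← Finset.sum_add_distrib]
    refine Finset.sum_congr rfl fun ω _ => ?_
    ring
  rw [h5, h1, h2, h3, h3]
  ring
end

section
/- Robustness of the frontdoor estimating function (mediator-density representation) under a correct mediator model: define b₀(m) = E(Y | A=a°, M=m), ψ₃ = ∑_m b₀(m)·P(M=m | A=a†), and Ψ = P(A=a†)·E(Y | A=a†) + P(A=a°)·ψ₃. Then for ANY function b₀* : ℳ → ℝ and ANY real number ψ₃*, E[ 1{A=a†}·Y + 1{A=a°}·ψ₃* + 1{A=a°}·(P(M | A=a†)/P(M | A=a°))·(Y − b₀*(M)) + 1{A=a†}·(P(A=a°)/P(A=a†))·(b₀*(M) − ψ₃*) ] = Ψ, where P(M | A=a)/ denotes the random variable ω ↦ P(M=M(ω) | A=a). -/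
open scoped Classical
open Finset

theorem fiber_aux_s10 {Ω 𝓜 α : Type*} [Fintype Ω] [Fintype 𝓜] (p : Ω → ℝ) (A : Ω → α) (a : α)
    (M : Ω → 𝓜) (Z : Ω → ℝ) (f : 𝓜 → ℝ) :
    ∑ ω, p ω * (ind (A ω = a) * f (M ω) * Z ω) =
      ∑ m, f m * Ex p (fun ω => Z ω * ind (A ω = a ∧ M ω = m)) := by
  unfold Ex
  simp_rw [Finset.mul_sum]
  rw [Finset.sum_comm]
  refine Finset.sum_congr rfl fun ω _ => ?_
  rw [Finset.sum_eq_single (M ω)]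
  · simp only [ind, and_true]
    ring
  · intro m _ hm
    simp [ind, hm.symm]
  · simp

theorem Pr_eq_aux {Ω : Type*} [Fintype Ω] (p : Ω → ℝ) (S : Ω → Prop) :
    Ex p (fun ω => 1 * ind (S ω)) = Pr p S := by
  simp [Ex, Pr, ind]

theorem CEx_eq_aux {Ω : Type*} [Fintype Ω] (p : Ω → ℝ) (X : Ω → ℝ) (S : Ω → Prop) :
    CEx p X S = Ex p (fun ω => X ω * ind (S ω)) / Pr p S := rfl

/-- Robustness of the frontdoor estimating function
(mediator-density representation) under a correct mediator model. -/
theorem frontdoor_robust_mediator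
    {Ω 𝓜 α : Type*} [Fintype Ω] [Fintype 𝓜]
    (p : Ω → ℝ) (hp : ∀ ω, 0 ≤ p ω) (hsum : ∑ ω, p ω = 1)
    (A : Ω → α) (adag acirc : α) (hne : adag ≠ acirc)
    (hA : ∀ ω, A ω = adag ∨ A ω = acirc)
    (M : Ω → 𝓜) (Y : Ω → ℝ)
    (hpos : ∀ a, (a = adag ∨ a = acirc) → ∀ m : 𝓜,
      0 < Pr p (fun ω => A ω = a ∧ M ω = m))
    (b0 : 𝓜 → ℝ)
    (hb0 : ∀ m, b0 m = CEx p Y (fun ω => A ω = acirc ∧ M ω = m))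
    (ψ3 : ℝ)
    (hψ3 : ψ3 = ∑ m : 𝓜, b0 m * CPr p (fun ω => M ω = m) (fun ω => A ω = adag))
    (Ψ : ℝ)
    (hΨ : Ψ = Pr p (fun ω => A ω = adag) * CEx p Y (fun ω => A ω = adag) +
              Pr p (fun ω => A ω = acirc) * ψ3)
    (b0star : 𝓜 → ℝ) (ψ3star : ℝ) :
    Ex p (fun ω =>
      ind (A ω = adag) * Y ω + ind (A ω = acirc) * ψ3star +
      ind (A ω = acirc) *
        (CPr p (fun ω' => M ω' = M ω) (fun ω' => A ω' = adag) /
         CPr p (fun ω' => M ω' = M ω) (fun ω' => A ω' = acirc)) *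
        (Y ω - b0star (M ω)) +
      ind (A ω = adag) *
        (Pr p (fun ω' => A ω' = acirc) / Pr p (fun ω' => A ω' = adag)) *
        (b0star (M ω) - ψ3star)) = Ψ := by
  have hΩ : Nonempty Ω := by
    by_contra h
    rw [not_nonempty_iff] at h
    simp at hsum
  obtain ⟨ω0⟩ := hΩ
  have hPpos : ∀ a, (a = adag ∨ a = acirc) → 0 < Pr p (fun ω => A ω = a) := by
    intro a ha
    refine lt_of_lt_of_le (hpos a ha (M ω0)) ?_
    unfold Pr
    refine Finset.sum_le_sum fun ω _ => ?_
    have := hp ω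
    by_cases h1 : A ω = a <;> by_cases h2 : M ω = M ω0 <;> simp [h1, h2, this]
  have hd := (hPpos adag (Or.inl rfl)).ne'
  have hc := (hPpos acirc (Or.inr rfl)).ne'
  have hJd := fun m => (hpos adag (Or.inl rfl) m).ne'
  have hJc := fun m => (hpos acirc (Or.inr rfl) m).ne'
  have hC : ∀ a m, CPr p (fun ω => M ω = m) (fun ω => A ω = a) =
      Pr p (fun ω => A ω = a ∧ M ω = m) / Pr p (fun ω => A ω = a) := by
    intro a m
    simp only [CPr, and_comm]
  have hI : ∀ a, ∑ ω, p ω * ind (A ω = a) = Pr p (fun ω => A ω = a) := by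
    intro a
    simp [ind, Pr]
  have hY : CEx p Y (fun ω => A ω = adag) =
      (∑ ω, p ω * (ind (A ω = adag) * Y ω)) / Pr p (fun ω => A ω = adag) := by
    simp only [CEx, Ex, ind, mul_comm]
  simp_rw [hC] at hψ3 ⊢
  set Pd := Pr p (fun ω => A ω = adag) with hPd
  set Pc := Pr p (fun ω => A ω = acirc) with hPc
  let r : 𝓜 → ℝ := fun m => (Pr p (fun ω => A ω = adag ∧ M ω = m) / Pd) /
    (Pr p (fun ω => A ω = acirc ∧ M ω = m) / Pc)
  have e1 := fiber_aux_s10 p A acirc M Y r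
  have e2 := fiber_aux_s10 p A acirc M (fun _ => 1) (fun m => r m * b0star m)
  have e3 := fiber_aux_s10 p A adag M (fun _ => 1) b0star
  simp only [Pr_eq_aux p (fun ω => A ω = _ ∧ M ω = _)] at e2 e3
  have k1 : ∑ m, r m * Ex p (fun ω => Y ω * ind (A ω = acirc ∧ M ω = m))
      = Pc * ψ3 := by
    rw [hψ3, Finset.mul_sum]
    refine Finset.sum_congr rfl fun m _ => ?_
    rw [hb0, CEx_eq_aux]
    have := hJc m
    simp only [r]
    field_simp
  have k2 : ∑ m, r m * b0star m * Pr p (fun ω => A ω = acirc ∧ M ω = m)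
      = Pc / Pd * ∑ m, b0star m * Pr p (fun ω => A ω = adag ∧ M ω = m) := by
    rw [Finset.mul_sum]
    refine Finset.sum_congr rfl fun m _ => ?_
    have := hJc m
    simp only [r]
    field_simp
  have key : Ex p (fun ω =>
      ind (A ω = adag) * Y ω + ind (A ω = acirc) * ψ3star +
      ind (A ω = acirc) * r (M ω) * (Y ω - b0star (M ω)) +
      ind (A ω = adag) * (Pc / Pd) * (b0star (M ω) - ψ3star)) =
      ∑ ω, p ω * (ind (A ω = adag) * Y ω) + ψ3star * ∑ ω, p ω * ind (A ω = acirc)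
      + ∑ ω, p ω * (ind (A ω = acirc) * r (M ω) * Y ω)
      - ∑ ω, p ω * (ind (A ω = acirc) * (r (M ω) * b0star (M ω)) * 1)
      + Pc / Pd * ∑ ω, p ω * (ind (A ω = adag) * b0star (M ω) * 1)
      - Pc / Pd * ψ3star * ∑ ω, p ω * ind (A ω = adag) := by
    unfold Ex
    simp only [Finset.mul_sum, ← Finset.sum_add_distrib, ← Finset.sum_sub_distrib]
    refine Finset.sum_congr rfl fun ω _ => ?_
    ring
  refine key.trans ?_
  rw [e1, e2, e3, k1, k2, hI, hI, hΨ, hY, ← hPd, ← hPc]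
  field_simp
  ring
end

section
/- Robustness of the generalized frontdoor estimating function, scenario 1 (mediator density and treatment-given-covariates models correct, outcome nuisances arbitrary): define b₀(m,l) = E(Y | A=a°, M=m, L=l), h†(l) = ∑_m b₀(m,l)·P(M=m | A=a†, L=l), ψ₃ = E(h†(L) | A=a°), and Ψ = P(A=a†)·E(Y | A=a†) + P(A=a°)·ψ₃. Then for ANY functions b₀* : ℳ×ℒ → ℝ, h* : ℒ → ℝ and ANY real number ψ₃*, E[ 1{A=a†}·Y + 1{A=a°}·ψ₃* + 1{A=a°}·(P(M | A=a†, L)/P(M | A=a°, L))·(Y − b₀*(M,L)) + 1{A=a†}·(P(A=a° | L)/P(A=a† | L))·(b₀*(M,L) − h*(L)) + 1{A=a°}·(h*(L) − ψ₃*) ] = Ψ, where P(M | A=a, L) denotes the random variable ω ↦ P(M=M(ω) | A=a, L=L(ω)) and P(A=a | L) denotes ω ↦ P(A=a | L=L(ω)). -/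
open scoped Classical
open Finset

theorem tower_aux {Ω 𝓜 𝓛 α : Type*} [Fintype Ω] [Fintype 𝓜] [Fintype 𝓛]
    (p : Ω → ℝ) (A : Ω → α) (M : Ω → 𝓜) (L : Ω → 𝓛) (X : Ω → ℝ) (a : α) (f : 𝓜 → 𝓛 → ℝ) :
    Ex p (fun ω => ind (A ω = a) * f (M ω) (L ω) * X ω) =
    ∑ l, ∑ m, f m l * Ex p (fun ω => X ω * (if (A ω = a ∧ M ω = m ∧ L ω = l) then 1 else 0)) := by
  unfold Ex ind
  simp_rw [Finset.mul_sum]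
  have h : ∀ l : 𝓛, ∑ m : 𝓜, ∑ ω, f m l * (p ω * (X ω * (if (A ω = a ∧ M ω = m ∧ L ω = l) then (1:ℝ) else 0)))
     = ∑ ω, ∑ m : 𝓜, f m l * (p ω * (X ω * (if (A ω = a ∧ M ω = m ∧ L ω = l) then (1:ℝ) else 0))) :=
    fun l => Finset.sum_comm
  simp_rw [h]
  rw [Finset.sum_comm]
  refine Finset.sum_congr rfl fun ω _ => ?_
  rw [Finset.sum_eq_single (L ω), Finset.sum_eq_single (M ω)]
  · by_cases h : A ω = a <;> simp [h]; ring
  · intro m _ hm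
    simp [hm.symm]
  · simp
  · intro l _ hl
    simp [hl.symm]
  · simp

theorem Ex_one_aux {Ω : Type*} [Fintype Ω] (p : Ω → ℝ) (S : Ω → Prop) [DecidablePred S] :
    Ex p (fun ω => 1 * (if S ω then 1 else 0)) = Pr p S := by
  unfold Ex Pr
  refine Finset.sum_congr rfl fun ω _ => ?_
  by_cases h : S ω <;> simp [h]

theorem tower_one_aux {Ω 𝓜 𝓛 α : Type*} [Fintype Ω] [Fintype 𝓜] [Fintype 𝓛]
    (p : Ω → ℝ) (A : Ω → α) (M : Ω → 𝓜) (L : Ω → 𝓛) (a : α) (f : 𝓜 → 𝓛 → ℝ) :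
    Ex p (fun ω => ind (A ω = a) * f (M ω) (L ω)) =
    ∑ l, ∑ m, f m l * Pr p (fun ω => A ω = a ∧ M ω = m ∧ L ω = l) := by
  have := tower_aux p A M L (fun _ => 1) a f
  simp only [mul_one] at this
  rw [this]
  refine Finset.sum_congr rfl fun l _ => Finset.sum_congr rfl fun m _ => ?_
  rw [← Ex_one_aux p (fun ω => A ω = a ∧ M ω = m ∧ L ω = l)]

theorem marg_aux {Ω 𝓜 𝓛 α : Type*} [Fintype Ω] [Fintype 𝓜]
    (p : Ω → ℝ) (A : Ω → α) (M : Ω → 𝓜) (L : Ω → 𝓛) (a : α) (l : 𝓛) :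
    ∑ m, Pr p (fun ω => A ω = a ∧ M ω = m ∧ L ω = l) = Pr p (fun ω => A ω = a ∧ L ω = l) := by
  unfold Pr
  rw [Finset.sum_comm]
  refine Finset.sum_congr rfl fun ω _ => ?_
  rw [Finset.sum_eq_single (M ω)]
  · simp
  · intro m _ hm
    simp [hm.symm]
  · simp

/-- Robustness of the generalized frontdoor estimating function,
scenario 1 (mediator density and treatment-given-covariates models correct,
outcome nuisances arbitrary). -/
theorem generalized_frontdoor_robust_scenario1
    {Ω 𝓜 𝓛 α : Type*} [Fintype Ω] [Fintype 𝓜] [Fintype 𝓛]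
    (p : Ω → ℝ) (hp : ∀ ω, 0 ≤ p ω) (hsum : ∑ ω, p ω = 1)
    (A : Ω → α) (adag acirc : α) (hne : adag ≠ acirc)
    (hA : ∀ ω, A ω = adag ∨ A ω = acirc)
    (M : Ω → 𝓜) (L : Ω → 𝓛) (Y : Ω → ℝ)
    (hpos : ∀ a, (a = adag ∨ a = acirc) → ∀ m : 𝓜, ∀ l : 𝓛,
      0 < Pr p (fun ω => A ω = a ∧ M ω = m ∧ L ω = l))
    (b0 : 𝓜 → 𝓛 → ℝ)
    (hb0 : ∀ m l, b0 m l = CEx p Y (fun ω => A ω = acirc ∧ M ω = m ∧ L ω = l))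
    (hdag : 𝓛 → ℝ)
    (hhdag : ∀ l, hdag l = ∑ m : 𝓜,
      b0 m l * CPr p (fun ω => M ω = m) (fun ω => A ω = adag ∧ L ω = l))
    (ψ3 : ℝ)
    (hψ3 : ψ3 = CEx p (fun ω => hdag (L ω)) (fun ω => A ω = acirc))
    (Ψ : ℝ)
    (hΨ : Ψ = Pr p (fun ω => A ω = adag) * CEx p Y (fun ω => A ω = adag) +
              Pr p (fun ω => A ω = acirc) * ψ3)
    (b0star : 𝓜 → 𝓛 → ℝ) (hstar : 𝓛 → ℝ) (ψ3star : ℝ) :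
    Ex p (fun ω =>
      ind (A ω = adag) * Y ω + ind (A ω = acirc) * ψ3star +
      ind (A ω = acirc) *
        (CPr p (fun ω' => M ω' = M ω) (fun ω' => A ω' = adag ∧ L ω' = L ω) /
         CPr p (fun ω' => M ω' = M ω) (fun ω' => A ω' = acirc ∧ L ω' = L ω)) *
        (Y ω - b0star (M ω) (L ω)) +
      ind (A ω = adag) *
        (CPr p (fun ω' => A ω' = acirc) (fun ω' => L ω' = L ω) /
         CPr p (fun ω' => A ω' = adag) (fun ω' => L ω' = L ω)) *
        (b0star (M ω) (L ω) - hstar (L ω)) +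
      ind (A ω = acirc) * (hstar (L ω) - ψ3star)) = Ψ := by
  obtain ⟨ω0⟩ : Nonempty Ω := by
    by_contra h
    rw [not_nonempty_iff] at h
    simp at hsum
  have hPA : ∀ a, (a = adag ∨ a = acirc) → Pr p (fun ω => A ω = a) ≠ 0 := fun a ha =>
    ((hpos a ha (M ω0) (L ω0)).trans_le (Pr_mono_aux p hp _ _ fun ω h => h.1)).ne'
  have hR : ∀ a, (a = adag ∨ a = acirc) → ∀ l, Pr p (fun ω => A ω = a ∧ L ω = l) ≠ 0 :=
    fun a ha l => ((hpos a ha (M ω0) l).trans_le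
      (Pr_mono_aux p hp _ _ fun ω h => ⟨h.1, h.2.2⟩)).ne'
  have hT : ∀ l, Pr p (fun ω => L ω = l) ≠ 0 :=
    fun l => ((hpos adag (Or.inl rfl) (M ω0) l).trans_le
      (Pr_mono_aux p hp _ _ fun ω h => h.2.2)).ne'
  have hQ := fun a ha m l => (hpos a ha m l).ne'
  have e1 : ∀ a m l, Pr p (fun ω => M ω = m ∧ A ω = a ∧ L ω = l) =
      Pr p (fun ω => A ω = a ∧ M ω = m ∧ L ω = l) := fun a m l => by
    congr 1; funext ω; exact propext and_left_comm
  have hdagv : ∀ l, hdag l = ∑ m, b0 m l * (Pr p (fun ω => A ω = adag ∧ M ω = m ∧ L ω = l) /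
      Pr p (fun ω => A ω = adag ∧ L ω = l)) := fun l => by
    rw [hhdag]; simp only [CPr, e1]
  have hYv : ∀ m l, Ex p (fun ω => Y ω * (if (A ω = acirc ∧ M ω = m ∧ L ω = l) then 1 else 0)) =
      b0 m l * Pr p (fun ω => A ω = acirc ∧ M ω = m ∧ L ω = l) := fun m l => by
    rw [hb0, CEx, div_mul_cancel₀ _ (hQ _ (Or.inr rfl) m l)]
    congr!
  have hΨ' : Ψ = Ex p (fun ω => ind (A ω = adag) * Y ω) +
      Ex p (fun ω => ind (A ω = acirc) * hdag (L ω)) := by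
    rw [hΨ, hψ3, CEx, CEx, mul_div_cancel₀ _ (hPA _ (Or.inl rfl)),
      mul_div_cancel₀ _ (hPA _ (Or.inr rfl))]
    simp only [ind, mul_comm]
  set rM : 𝓜 → 𝓛 → ℝ := fun m l =>
    CPr p (fun ω' => M ω' = m) (fun ω' => A ω' = adag ∧ L ω' = l) /
         CPr p (fun ω' => M ω' = m) (fun ω' => A ω' = acirc ∧ L ω' = l) with hrM
  set rA : 𝓛 → ℝ := fun l => CPr p (fun ω' => A ω' = acirc) (fun ω' => L ω' = l) /
         CPr p (fun ω' => A ω' = adag) (fun ω' => L ω' = l) with hrA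
  have hrMv : ∀ m l, rM m l * Pr p (fun ω => A ω = acirc ∧ M ω = m ∧ L ω = l) =
      Pr p (fun ω => A ω = adag ∧ M ω = m ∧ L ω = l) / Pr p (fun ω => A ω = adag ∧ L ω = l) *
        Pr p (fun ω => A ω = acirc ∧ L ω = l) := fun m l => by
    have h1 := hR _ (Or.inl rfl) l
    have h2 := hR _ (Or.inr rfl) l
    have h3 := hQ _ (Or.inr rfl) m l
    simp only [hrM, CPr, e1]
    field_simp
  have hrAv : ∀ l, rA l = Pr p (fun ω => A ω = acirc ∧ L ω = l) /
      Pr p (fun ω => A ω = adag ∧ L ω = l) := fun l => by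
    have h1 := hR _ (Or.inl rfl) l
    have h3 := hT l
    simp only [hrA, CPr]
    field_simp
  have split : Ex p (fun ω =>
      ind (A ω = adag) * Y ω + ind (A ω = acirc) * ψ3star +
      ind (A ω = acirc) * rM (M ω) (L ω) * (Y ω - b0star (M ω) (L ω)) +
      ind (A ω = adag) * rA (L ω) * (b0star (M ω) (L ω) - hstar (L ω)) +
      ind (A ω = acirc) * (hstar (L ω) - ψ3star)) =
      Ex p (fun ω => ind (A ω = adag) * Y ω) +
      Ex p (fun ω => ind (A ω = acirc) * rM (M ω) (L ω) * Y ω) +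
      Ex p (fun ω => ind (A ω = acirc) *
        (hstar (L ω) - rM (M ω) (L ω) * b0star (M ω) (L ω))) +
      Ex p (fun ω => ind (A ω = adag) * (rA (L ω) * (b0star (M ω) (L ω) - hstar (L ω)))) := by
    unfold Ex
    simp only [← Finset.sum_add_distrib]
    exact Finset.sum_congr rfl fun ω _ => by ring
  refine split.trans ?_
  rw [hΨ', tower_aux p A M L Y acirc rM,
    tower_one_aux p A M L acirc (fun m l => hstar l - rM m l * b0star m l),
    tower_one_aux p A M L adag (fun m l => rA l * (b0star m l - hstar l)),
    tower_one_aux p A M L acirc (fun _ l => hdag l), add_assoc, add_assoc]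
  congr 1
  simp only [← Finset.sum_add_distrib]
  refine Finset.sum_congr rfl fun l _ => ?_
  rw [← Finset.mul_sum, marg_aux, hdagv, Finset.sum_mul]
  have h1 := hR _ (Or.inl rfl) l
  have key : ∀ m, rM m l * Ex p (fun ω => Y ω * (if (A ω = acirc ∧ M ω = m ∧ L ω = l) then 1 else 0)) +
      ((hstar l - rM m l * b0star m l) * Pr p (fun ω => A ω = acirc ∧ M ω = m ∧ L ω = l) +
       rA l * (b0star m l - hstar l) * Pr p (fun ω => A ω = adag ∧ M ω = m ∧ L ω = l)) =
      b0 m l * (Pr p (fun ω => A ω = adag ∧ M ω = m ∧ L ω = l) /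
        Pr p (fun ω => A ω = adag ∧ L ω = l)) * Pr p (fun ω => A ω = acirc ∧ L ω = l) +
      (hstar l * Pr p (fun ω => A ω = acirc ∧ M ω = m ∧ L ω = l) -
       rA l * hstar l * Pr p (fun ω => A ω = adag ∧ M ω = m ∧ L ω = l)) := fun m => by
    rw [hYv, hrAv]
    linear_combination (b0 m l - b0star m l) * hrMv m l
  rw [Finset.sum_congr rfl fun m _ => key m, Finset.sum_add_distrib, Finset.sum_sub_distrib,
    ← Finset.mul_sum, ← Finset.mul_sum, marg_aux, marg_aux, hrAv]
  have hz : hstar l * Pr p (fun ω => A ω = acirc ∧ L ω = l) -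
      Pr p (fun ω => A ω = acirc ∧ L ω = l) / Pr p (fun ω => A ω = adag ∧ L ω = l) * hstar l *
        Pr p (fun ω => A ω = adag ∧ L ω = l) = 0 := by
    field_simp
    ring
  rw [hz, add_zero]
end

section
/- Robustness of the generalized frontdoor estimating function, scenario 2 (outcome regressions b₀ and h† correct, density-ratio models arbitrary): define b₀(m,l) = E(Y | A=a°, M=m, L=l), h†(l) = ∑_m b₀(m,l)·P(M=m | A=a†, L=l), ψ₃ = E(h†(L) | A=a°), and Ψ = P(A=a†)·E(Y | A=a†) + P(A=a°)·ψ₃. Then for ANY functions w : ℳ×ℒ → ℝ (arbitrary mediator density ratio), v : ℒ → ℝ (arbitrary propensity odds), and ANY real number ψ₃*, E[ 1{A=a†}·Y + 1{A=a°}·ψ₃* + 1{A=a°}·w(M,L)·(Y − b₀(M,L)) + 1{A=a†}·v(L)·(b₀(M,L) − h†(L)) + 1{A=a°}·(h†(L) − ψ₃*) ] = Ψ. -/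
open scoped Classical
open Finset

theorem fib_aux {Ω β : Type*} [Fintype Ω] [Fintype β] (g : Ω → β) (F : Ω → ℝ) :
    ∑ ω, F ω = ∑ b, ∑ ω, if g ω = b then F ω else 0 := by
  rw [Finset.sum_comm]
  simp

theorem Pr_pos_mono {Ω : Type*} [Fintype Ω] (p : Ω → ℝ) (hp : ∀ ω, 0 ≤ p ω)
    (S T : Ω → Prop) (h : ∀ ω, S ω → T ω) (hS : 0 < Pr p S) : 0 < Pr p T := by
  refine lt_of_lt_of_le hS (Finset.sum_le_sum fun ω _ => ?_)
  by_cases h1 : S ω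
  · simp [h1, h ω h1]
  · simp only [h1, if_false]
    split_ifs
    · exact hp ω
    · exact le_rfl

theorem Pr_mul_CEx {Ω : Type*} [Fintype Ω] (p X : Ω → ℝ) (S : Ω → Prop) (hS : 0 < Pr p S) :
    Pr p S * CEx p X S = ∑ ω, if S ω then p ω * X ω else 0 := by
  unfold CEx
  rw [mul_div_cancel₀ _ hS.ne']
  unfold Ex
  refine Finset.sum_congr rfl fun ω _ => ?_
  by_cases h : S ω <;> simp [h]

/-- Robustness of the generalized frontdoor estimating function,
scenario 2 (outcome regressions `b0` and `h†` correct, density-ratio models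
arbitrary). -/
theorem generalized_frontdoor_robust_scenario2
    {Ω 𝓜 𝓛 α : Type*} [Fintype Ω] [Fintype 𝓜] [Fintype 𝓛]
    (p : Ω → ℝ) (hp : ∀ ω, 0 ≤ p ω) (hsum : ∑ ω, p ω = 1)
    (A : Ω → α) (adag acirc : α) (hne : adag ≠ acirc)
    (hA : ∀ ω, A ω = adag ∨ A ω = acirc)
    (M : Ω → 𝓜) (L : Ω → 𝓛) (Y : Ω → ℝ)
    (hpos : ∀ a, (a = adag ∨ a = acirc) → ∀ m : 𝓜, ∀ l : 𝓛,
      0 < Pr p (fun ω => A ω = a ∧ M ω = m ∧ L ω = l))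
    (b0 : 𝓜 → 𝓛 → ℝ)
    (hb0 : ∀ m l, b0 m l = CEx p Y (fun ω => A ω = acirc ∧ M ω = m ∧ L ω = l))
    (hdag : 𝓛 → ℝ)
    (hhdag : ∀ l, hdag l = ∑ m : 𝓜,
      b0 m l * CPr p (fun ω => M ω = m) (fun ω => A ω = adag ∧ L ω = l))
    (ψ3 : ℝ)
    (hψ3 : ψ3 = CEx p (fun ω => hdag (L ω)) (fun ω => A ω = acirc))
    (Ψ : ℝ)
    (hΨ : Ψ = Pr p (fun ω => A ω = adag) * CEx p Y (fun ω => A ω = adag) +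
              Pr p (fun ω => A ω = acirc) * ψ3)
    (w : 𝓜 → 𝓛 → ℝ) (v : 𝓛 → ℝ) (ψ3star : ℝ) :
    Ex p (fun ω =>
      ind (A ω = adag) * Y ω + ind (A ω = acirc) * ψ3star +
      ind (A ω = acirc) * w (M ω) (L ω) * (Y ω - b0 (M ω) (L ω)) +
      ind (A ω = adag) * v (L ω) * (b0 (M ω) (L ω) - hdag (L ω)) +
      ind (A ω = acirc) * (hdag (L ω) - ψ3star)) = Ψ := by
  obtain ⟨ω0⟩ : Nonempty Ω := by
    by_contra h
    rw [not_nonempty_iff] at h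
    simp at hsum
  have hPd : 0 < Pr p (fun ω => A ω = adag) :=
    Pr_pos_mono p hp _ _ (fun ω h => h.1) (hpos adag (Or.inl rfl) (M ω0) (L ω0))
  have hPc : 0 < Pr p (fun ω => A ω = acirc) :=
    Pr_pos_mono p hp _ _ (fun ω h => h.1) (hpos acirc (Or.inr rfl) (M ω0) (L ω0))
  have hPdl : ∀ l, 0 < Pr p (fun ω => A ω = adag ∧ L ω = l) := fun l =>
    Pr_pos_mono p hp _ _ (fun ω h => ⟨h.1, h.2.2⟩) (hpos adag (Or.inl rfl) (M ω0) l)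
  have hW : ∑ ω, p ω * (ind (A ω = acirc) * w (M ω) (L ω) * (Y ω - b0 (M ω) (L ω))) = 0 := by
    rw [fib_aux (fun ω => (M ω, L ω))]
    refine Finset.sum_eq_zero fun ml _ => ?_
    obtain ⟨m, l⟩ := ml
    have h := Pr_mul_CEx p Y _ (hpos acirc (Or.inr rfl) m l)
    rw [← hb0, Pr, Finset.sum_mul] at h
    have h2 := sub_eq_zero.mpr h.symm
    rw [← Finset.sum_sub_distrib] at h2
    refine Eq.trans ?_ ((congrArg (fun t => w m l * t) h2).trans (mul_zero _))
    simp only [Finset.mul_sum]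
    refine Finset.sum_congr rfl fun ω _ => ?_
    by_cases h1 : M ω = m <;> by_cases h3 : L ω = l <;> by_cases h4 : A ω = acirc <;>
      simp [h1, h3, h4, ind]
    ring
  have hV : ∑ ω, p ω * (ind (A ω = adag) * v (L ω) * (b0 (M ω) (L ω) - hdag (L ω))) = 0 := by
    rw [fib_aux L]
    refine Finset.sum_eq_zero fun l _ => ?_
    have h : Pr p (fun ω => A ω = adag ∧ L ω = l) * hdag l =
        ∑ ω, if A ω = adag ∧ L ω = l then p ω * b0 (M ω) l else 0 := by
      rw [hhdag, Finset.mul_sum, fib_aux M]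
      refine Finset.sum_congr rfl fun m _ => ?_
      unfold CPr
      rw [mul_left_comm, mul_div_cancel₀ _ (hPdl l).ne', Pr, Finset.mul_sum]
      refine Finset.sum_congr rfl fun ω _ => ?_
      by_cases h1 : M ω = m <;> by_cases h3 : L ω = l <;> by_cases h4 : A ω = adag <;>
        simp [h1, h3, h4, mul_comm]
    rw [Pr, Finset.sum_mul] at h
    have h2 := sub_eq_zero.mpr h.symm
    rw [← Finset.sum_sub_distrib] at h2
    refine Eq.trans ?_ ((congrArg (fun t => v l * t) h2).trans (mul_zero _))
    simp only [Finset.mul_sum]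
    refine Finset.sum_congr rfl fun ω _ => ?_
    by_cases h3 : L ω = l <;> by_cases h4 : A ω = adag <;> simp [h3, h4, ind]
    ring
  rw [hΨ, hψ3, Pr_mul_CEx p _ _ hPd, Pr_mul_CEx p _ _ hPc]
  refine Eq.trans ?_ ((congrArg₂ (fun s t => _ + s + t) hW hV).trans
    ((add_zero _).trans (add_zero _)))
  simp only [← Finset.sum_add_distrib]
  unfold Ex
  refine Finset.sum_congr rfl fun ω _ => ?_
  rcases hA ω with h4 | h4
  · simp [h4, hne, ind]
    ring
  · simp [h4, hne.symm, ind]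
    ring
end
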